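/- Splitting of cone isometries: Let C(Z) be the metric cone over a compact metric space Z of diameter < π, with cone point z*. Then every isometry of C(Z) fixes the cone point z* and is induced by an isometry of Z (so Isom(C(Z)) ≅ Isom(Z)), and the isometry group of the product R^m × C(Z) splits as Isom(R^m × C(Z)) = Isom(R^m) × Isom(C(Z)); in particular, for every isometry h of R^m × C(Z) there is a unique pair (h_1, h_2) ∈ Isom(R^m) × Isom(C(Z)) with h(u,z) = (h_1(u), h_2(z)) for all (u,z), and h_2(z*) = z*. -/

import Mathlib

open Metric Filter Function
open scoped Topology


/-! The metric cone `C(Z)` over a metric space `Z` with `diam Z < π`: the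
quotient of `[0, ∞) × Z` in which all points `(0, z)` are identified to the
cone point `z*`, with the cone distance
`d((s, z₁), (t, z₂))² = s² + t² - 2 s t cos (d_Z(z₁, z₂))`. -/

/-- the relation on `[0, ∞) × Z` identifying all points with first
coordinate `0` -/
def coneSetoid (Z : Type*) : Setoid ({ t : ℝ // 0 ≤ t } × Z) where
  r a b := a = b ∨ ((a.1 : ℝ) = 0 ∧ (b.1 : ℝ) = 0)
  iseqv := by
    constructor
    · exact fun _ => Or.inl rfl
    · rintro a b (rfl | ⟨h₁, h₂⟩)
      · exact Or.inl rfl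
      · exact Or.inr ⟨h₂, h₁⟩
    · rintro a b c (rfl | ⟨h₁, h₂⟩) (rfl | ⟨h₃, h₄⟩)
      · exact Or.inl rfl
      · exact Or.inr ⟨h₃, h₄⟩
      · exact Or.inr ⟨h₁, h₂⟩
      · exact Or.inr ⟨h₁, h₄⟩

/-- the metric cone over `Z`, as a set -/
def MetricCone (Z : Type*) : Type _ := Quotient (coneSetoid Z)

/-- the cone point `z*` of `C(Z)` -/
def conePt (Z : Type*) (z : Z) : MetricCone Z :=
  Quotient.mk (coneSetoid Z) (⟨0, le_rfl⟩, z)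

/-- the cone distance on representatives:
`d((s, z₁), (t, z₂)) = √(s² + t² - 2 s t cos(d_Z(z₁, z₂)))` -/
noncomputable def coneDistRep {Z : Type*} [MetricSpace Z]
    (a b : { t : ℝ // 0 ≤ t } × Z) : ℝ :=
  Real.sqrt ((a.1 : ℝ) ^ 2 + (b.1 : ℝ) ^ 2 -
    2 * (a.1 : ℝ) * (b.1 : ℝ) * Real.cos (dist a.2 b.2))

/-- the cone distance on `C(Z)` -/
noncomputable def coneDist (Z : Type*) [MetricSpace Z] :
    MetricCone Z → MetricCone Z → ℝ := fun A B =>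
  sInf {r : ℝ | ∃ a b : { t : ℝ // 0 ≤ t } × Z,
    Quotient.mk (coneSetoid Z) a = A ∧ Quotient.mk (coneSetoid Z) b = B ∧
    r = coneDistRep a b}

/-- the `l²`-product distance on `ℝᵐ × C(Z)` -/
noncomputable def prodConeDist (Z : Type*) [MetricSpace Z] (m : ℕ) :
    EuclideanSpace ℝ (Fin m) × MetricCone Z →
      EuclideanSpace ℝ (Fin m) × MetricCone Z → ℝ :=
  fun a b => Real.sqrt (‖a.1 - b.1‖ ^ 2 + coneDist Z a.2 b.2 ^ 2)

section ConeDistance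

variable {Z : Type*} [MetricSpace Z]

theorem coneDist_mk (a b : { t : ℝ // 0 ≤ t } × Z) :
    coneDist Z (Quotient.mk (coneSetoid Z) a) (Quotient.mk (coneSetoid Z) b) =
      coneDistRep a b := by
  have key : {r : ℝ | ∃ a' b' : { t : ℝ // 0 ≤ t } × Z,
      Quotient.mk (coneSetoid Z) a' = Quotient.mk (coneSetoid Z) a ∧
      Quotient.mk (coneSetoid Z) b' = Quotient.mk (coneSetoid Z) b ∧
      r = coneDistRep a' b'} = {coneDistRep a b} := by
    ext r
    simp only [Set.mem_ofPred_eq, Set.mem_singleton_iff]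
    constructor
    · rintro ⟨a', b', ha, hb, rfl⟩
      have ha' : a' = a ∨ ((a'.1 : ℝ) = 0 ∧ (a.1 : ℝ) = 0) := Quotient.exact ha
      have hb' : b' = b ∨ ((b'.1 : ℝ) = 0 ∧ (b.1 : ℝ) = 0) := Quotient.exact hb
      rcases ha' with rfl | ⟨h₁, h₂⟩ <;> rcases hb' with rfl | ⟨h₃, h₄⟩ <;>
        simp [coneDistRep, *]
    · rintro rfl
      exact ⟨a, b, rfl, rfl, rfl⟩
  unfold coneDist
  rw [key, csInf_singleton]

theorem coneDist_mk_sq (s t : { t : ℝ // 0 ≤ t }) (z w : Z) :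
    coneDist Z (Quotient.mk (coneSetoid Z) (s, z)) (Quotient.mk (coneSetoid Z) (t, w)) ^ 2 =
      (s : ℝ) ^ 2 + (t : ℝ) ^ 2 - 2 * (s : ℝ) * (t : ℝ) * Real.cos (dist z w) := by
  rw [coneDist_mk]
  refine Real.sq_sqrt ?_
  have h := mul_le_mul_of_nonneg_left (Real.cos_le_one (dist z w)) (mul_nonneg s.2 t.2)
  nlinarith [sq_nonneg ((s : ℝ) - t)]

theorem coneDist_nonneg (A B : MetricCone Z) : 0 ≤ coneDist Z A B := by
  induction A using Quotient.inductionOn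
  induction B using Quotient.inductionOn
  rw [coneDist_mk]
  exact Real.sqrt_nonneg _

theorem coneDist_comm (A B : MetricCone Z) : coneDist Z A B = coneDist Z B A := by
  induction A using Quotient.inductionOn
  induction B using Quotient.inductionOn
  rw [coneDist_mk, coneDist_mk, coneDistRep, coneDistRep, dist_comm]
  ring_nf

theorem coneDist_mk_conePt (z₀ : Z) (t : { t : ℝ // 0 ≤ t }) (z : Z) :
    coneDist Z (Quotient.mk (coneSetoid Z) (t, z)) (conePt Z z₀) = t := by
  rw [conePt, coneDist_mk]
  simp [coneDistRep, Real.sqrt_sq t.2]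

theorem mk_eq_conePt {Z : Type*} (z₀ z : Z) {t : { t : ℝ // 0 ≤ t }} (ht : (t : ℝ) = 0) :
    Quotient.mk (coneSetoid Z) (t, z) = conePt Z z₀ :=
  Quotient.sound (Or.inr ⟨ht, rfl⟩)

theorem eq_conePt_of_coneDist_eq_zero (z₀ : Z) {A : MetricCone Z}
    (hA : coneDist Z A (conePt Z z₀) = 0) : A = conePt Z z₀ := by
  induction A using Quotient.inductionOn with | h a =>
  obtain ⟨t, z⟩ := a
  rw [coneDist_mk_conePt] at hA
  exact mk_eq_conePt z₀ z hA

@[simp]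
theorem coneDist_self (A : MetricCone Z) : coneDist Z A A = 0 := by
  induction A using Quotient.inductionOn with | h a =>
  obtain ⟨t, z⟩ := a
  have h := coneDist_mk_sq t t z z
  rw [dist_self, Real.cos_zero] at h
  exact pow_eq_zero_iff two_ne_zero |>.1 (h.trans (by ring))

theorem eq_of_cos_dist_eq_one (hπ : ∀ z w : Z, dist z w < Real.pi) {z w : Z}
    (h : Real.cos (dist z w) = 1) : z = w := by
  have hlt := hπ z w
  have hnn : 0 ≤ dist z w := dist_nonneg
  rw [Real.cos_eq_one_iff_of_lt_of_lt (by linarith [Real.pi_pos]) (by linarith)] at h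
  exact dist_eq_zero.1 h

theorem eq_of_coneDist_eq_zero (hπ : ∀ z w : Z, dist z w < Real.pi) {A B : MetricCone Z}
    (h : coneDist Z A B = 0) : A = B := by
  induction A using Quotient.inductionOn with | h a =>
  induction B using Quotient.inductionOn with | h b =>
  obtain ⟨s, z⟩ := a
  obtain ⟨t, w⟩ := b
  have hsq := coneDist_mk_sq s t z w
  rw [h] at hsq
  have hcos := Real.cos_le_one (dist z w)
  have hmul := mul_le_mul_of_nonneg_left hcos (mul_nonneg s.2 t.2)
  have hst : (s : ℝ) = t := by
    have : ((s : ℝ) - t) ^ 2 = 0 := le_antisymm (by nlinarith) (sq_nonneg _)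
    linarith [pow_eq_zero_iff two_ne_zero |>.1 this]
  obtain rfl : s = t := Subtype.ext hst
  rcases eq_or_ne (s : ℝ) 0 with hs | hs
  · exact Quotient.sound (Or.inr ⟨hs, hs⟩)
  · have : Real.cos (dist z w) = 1 := by
      have h2 : (s : ℝ) ^ 2 ≠ 0 := pow_ne_zero _ hs
      apply mul_left_cancel₀ h2
      linarith
    rw [eq_of_cos_dist_eq_one hπ this]

theorem coneDist_le_add_conePt (z₀ : Z) (A B : MetricCone Z) :
    coneDist Z A B ≤ coneDist Z A (conePt Z z₀) + coneDist Z B (conePt Z z₀) := by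
  induction A using Quotient.inductionOn with | h a =>
  induction B using Quotient.inductionOn with | h b =>
  obtain ⟨s, z⟩ := a
  obtain ⟨t, w⟩ := b
  rw [coneDist_mk_conePt, coneDist_mk_conePt]
  refine le_of_sq_le_sq ?_ (add_nonneg s.2 t.2)
  rw [coneDist_mk_sq]
  have h := mul_le_mul_of_nonneg_left (Real.neg_one_le_cos (dist z w)) (mul_nonneg s.2 t.2)
  nlinarith

/-- The cone point is not an interior point of any geodesic. -/
theorem coneDist_conePt_mul_eq_zero (hπ : ∀ z w : Z, dist z w < Real.pi) (z₀ : Z)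
    {A B : MetricCone Z}
    (h : coneDist Z A B = coneDist Z A (conePt Z z₀) + coneDist Z B (conePt Z z₀)) :
    coneDist Z A (conePt Z z₀) * coneDist Z B (conePt Z z₀) = 0 := by
  induction A using Quotient.inductionOn with | h a =>
  induction B using Quotient.inductionOn with | h b =>
  obtain ⟨s, z⟩ := a
  obtain ⟨t, w⟩ := b
  have hsq := coneDist_mk_sq s t z w
  rw [h, coneDist_mk_conePt, coneDist_mk_conePt] at hsq
  rw [coneDist_mk_conePt, coneDist_mk_conePt]
  have hcos : Real.cos Real.pi < Real.cos (dist z w) :=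
    Real.cos_lt_cos_of_nonneg_of_le_pi dist_nonneg le_rfl (hπ z w)
  rw [Real.cos_pi] at hcos
  have : (s : ℝ) * t * (1 + Real.cos (dist z w)) = 0 := by linarith
  exact (mul_eq_zero.1 this).resolve_right (by linarith)

end ConeDistance

section ProductDistance

variable {Z : Type*} [MetricSpace Z] {m : ℕ}

theorem prodConeDist_sq (p q : EuclideanSpace ℝ (Fin m) × MetricCone Z) :
    prodConeDist Z m p q ^ 2 = ‖p.1 - q.1‖ ^ 2 + coneDist Z p.2 q.2 ^ 2 :=
  Real.sq_sqrt (by positivity)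

/-- `p` is a metric midpoint of `q` and `r` in `ℝᵐ × C(Z)`. -/
def IsConeMidpoint (Z : Type*) [MetricSpace Z] (m : ℕ)
    (q p r : EuclideanSpace ℝ (Fin m) × MetricCone Z) : Prop :=
  prodConeDist Z m q r = 2 * prodConeDist Z m q p ∧
    prodConeDist Z m q r = 2 * prodConeDist Z m r p

/-- Points on the apex `ℝᵐ × {z*}` are midpoints only of pairs on the apex. -/
theorem IsConeMidpoint.eq_conePt (hπ : ∀ z w : Z, dist z w < Real.pi) {z₀ : Z}
    {q p r : EuclideanSpace ℝ (Fin m) × MetricCone Z} (h : IsConeMidpoint Z m q p r)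
    (hp : p.2 = conePt Z z₀) :
    q.2 = conePt Z z₀ ∧ r.2 = conePt Z z₀ := by
  obtain ⟨x, A⟩ := q
  obtain ⟨u, C⟩ := p
  obtain ⟨y, B⟩ := r
  obtain ⟨h₁, h₂⟩ := h
  dsimp only at hp ⊢
  subst hp
  have hq := prodConeDist_sq (x, A) (y, B)
  have h₁' := prodConeDist_sq (x, A) (u, conePt Z z₀)
  have h₂' := prodConeDist_sq (y, B) (u, conePt Z z₀)
  have hq' := hq
  rw [h₁] at hq
  rw [h₂] at hq'
  dsimp only at hq hq' h₁' h₂'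
  have hE := coneDist_le_add_conePt z₀ A B
  have hE0 := coneDist_nonneg A B
  have hEz := coneDist_conePt_mul_eq_zero hπ z₀ (A := A) (B := B)
  have hA0 := eq_conePt_of_coneDist_eq_zero z₀ (A := A)
  have hB0 := eq_conePt_of_coneDist_eq_zero z₀ (A := B)
  have hpar := parallelogram_law_with_norm ℝ (x - u) (y - u)
  rw [sub_sub_sub_cancel_right] at hpar
  generalize coneDist Z A (conePt Z z₀) = a at *
  generalize coneDist Z B (conePt Z z₀) = b at *
  generalize coneDist Z A B = e at *
  have he2 : e ^ 2 ≤ (a + b) ^ 2 := pow_le_pow_left₀ hE0 hE 2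
  have hsum : ‖x - u + (y - u)‖ ^ 2 + (a - b) ^ 2 + ((a + b) ^ 2 - e ^ 2) = 0 := by
    linarith
  have hab : (a - b) ^ 2 = 0 := by
    nlinarith [sq_nonneg ‖x - u + (y - u)‖, sq_nonneg (a - b)]
  have hab' : a = b := sub_eq_zero.1 (pow_eq_zero_iff two_ne_zero |>.1 hab)
  have hee : e = a + b := by
    have : e ^ 2 = (a + b) ^ 2 := by nlinarith [sq_nonneg ‖x - u + (y - u)‖]
    exact (pow_left_inj₀ hE0 (hE0.trans hE) two_ne_zero).1 this
  have hprod := hEz hee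
  subst hab'
  have ha : a = 0 := mul_self_eq_zero.1 hprod
  exact ⟨hA0 ha, hB0 ha⟩

/-- The apex `ℝᵐ × {z*}` consists of the points `p` for which every geodesic from `p` that
extends backwards past `p` also extends forwards to twice its length. -/
theorem snd_eq_conePt_iff (hπ : ∀ z w : Z, dist z w < Real.pi) (z₀ : Z)
    (p : EuclideanSpace ℝ (Fin m) × MetricCone Z) :
    p.2 = conePt Z z₀ ↔
      ∀ q r, IsConeMidpoint Z m q p r → ∃ q', IsConeMidpoint Z m q' q p := by
  constructor
  · intro hp q r h
    obtain ⟨hq, -⟩ := h.eq_conePt hπ hp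
    obtain ⟨u, C⟩ := p
    obtain ⟨x, A⟩ := q
    dsimp only at hp hq
    subst hp hq
    refine ⟨(x + (x - u), conePt Z z₀), ?_⟩
    have e₁ : x + (x - u) - u = (2 : ℝ) • (x - u) := by rw [two_smul]; abel
    constructor <;>
      simp [prodConeDist, e₁, norm_smul, Real.sqrt_sq, norm_sub_rev u x,
        Real.sqrt_sq (mul_nonneg zero_le_two (norm_nonneg (x - u)))]
  · intro h
    obtain ⟨u, C⟩ := p
    induction C using Quotient.inductionOn with | h c =>
    obtain ⟨s, z⟩ := c
    have hmid : IsConeMidpoint Z m (u, conePt Z z₀) (u, Quotient.mk (coneSetoid Z) (s, z))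
        (u, Quotient.mk (coneSetoid Z) (⟨2 * s, mul_nonneg zero_le_two s.2⟩, z)) := by
      have e₁ : coneDist Z (Quotient.mk (coneSetoid Z) (⟨2 * s, mul_nonneg zero_le_two s.2⟩, z))
          (Quotient.mk (coneSetoid Z) (s, z)) ^ 2 = (s : ℝ) ^ 2 := by
        rw [coneDist_mk_sq, dist_self, Real.cos_zero]
        ring
      have e₂ : ∀ t, coneDist Z (conePt Z z₀) (Quotient.mk (coneSetoid Z) (t, z)) = t :=
        fun t => (coneDist_comm _ _).trans (coneDist_mk_conePt z₀ t z)
      constructor <;>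
        simp [prodConeDist, e₁, e₂, Real.sqrt_sq (mul_nonneg zero_le_two s.2),
          Real.sqrt_sq s.2]
    obtain ⟨q', hq'⟩ := h _ _ hmid
    exact (hq'.eq_conePt hπ rfl).2

variable {h : EuclideanSpace ℝ (Fin m) × MetricCone Z →
  EuclideanSpace ℝ (Fin m) × MetricCone Z}

theorem map_snd_eq_conePt_iff (hπ : ∀ z w : Z, dist z w < Real.pi) (z₀ : Z)
    (hbij : Function.Bijective h)
    (hiso : ∀ a b, prodConeDist Z m (h a) (h b) = prodConeDist Z m a b)
    (p : EuclideanSpace ℝ (Fin m) × MetricCone Z) :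
    (h p).2 = conePt Z z₀ ↔ p.2 = conePt Z z₀ := by
  rw [snd_eq_conePt_iff hπ, snd_eq_conePt_iff hπ]
  have hmid : ∀ q p r, IsConeMidpoint Z m (h q) (h p) (h r) ↔ IsConeMidpoint Z m q p r :=
    fun q p r => by simp only [IsConeMidpoint, hiso]
  constructor
  · intro H q r hqr
    obtain ⟨q', hq'⟩ := H (h q) (h r) ((hmid _ _ _).2 hqr)
    obtain ⟨q', rfl⟩ := hbij.surjective q'
    exact ⟨q', (hmid _ _ _).1 hq'⟩
  · intro H q r hqr
    obtain ⟨q, rfl⟩ := hbij.surjective q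
    obtain ⟨r, rfl⟩ := hbij.surjective r
    obtain ⟨q', hq'⟩ := H q r ((hmid _ _ _).1 hqr)
    exact ⟨h q', (hmid _ _ _).2 hq'⟩

end ProductDistance

section Splitting

variable {Z : Type*} [MetricSpace Z] {m : ℕ}

theorem prodCone_isometry_splits (hπ : ∀ z w : Z, dist z w < Real.pi) (z₀ : Z)
    {h : EuclideanSpace ℝ (Fin m) × MetricCone Z → EuclideanSpace ℝ (Fin m) × MetricCone Z}
    (hbij : Function.Bijective h)
    (hiso : ∀ a b, prodConeDist Z m (h a) (h b) = prodConeDist Z m a b) :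
    ∃ (h₁ : EuclideanSpace ℝ (Fin m) ≃ᵢ EuclideanSpace ℝ (Fin m))
      (h₂ : MetricCone Z → MetricCone Z),
      Function.Bijective h₂ ∧
      (∀ a b : MetricCone Z, coneDist Z (h₂ a) (h₂ b) = coneDist Z a b) ∧
      (∀ (u : EuclideanSpace ℝ (Fin m)) (a : MetricCone Z), h (u, a) = (h₁ u, h₂ a)) ∧
      h₂ (conePt Z z₀) = conePt Z z₀ := by
  have hapex := map_snd_eq_conePt_iff hπ z₀ hbij hiso
  have hsq : ∀ p q, ‖(h p).1 - (h q).1‖ ^ 2 + coneDist Z (h p).2 (h q).2 ^ 2 =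
      ‖p.1 - q.1‖ ^ 2 + coneDist Z p.2 q.2 ^ 2 := fun p q => by
    rw [← prodConeDist_sq, ← prodConeDist_sq, hiso]
  have hz : ∀ u, (h (u, conePt Z z₀)).2 = conePt Z z₀ := fun u => (hapex _).2 rfl
  set f : EuclideanSpace ℝ (Fin m) → EuclideanSpace ℝ (Fin m) :=
    fun u => (h (u, conePt Z z₀)).1 with hf
  have hfiso : Isometry f := Isometry.of_dist_eq fun u v => by
    have := hsq (u, conePt Z z₀) (v, conePt Z z₀)
    simp only [hz, coneDist_self] at this
    rw [dist_eq_norm, dist_eq_norm]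
    exact (pow_left_inj₀ (norm_nonneg _) (norm_nonneg _) two_ne_zero).1 (by linarith)
  have hfsurj : Function.Surjective f := fun v => by
    obtain ⟨⟨u, a⟩, hua⟩ := hbij.surjective (v, conePt Z z₀)
    obtain rfl : a = conePt Z z₀ := (hapex (u, a)).1 (by rw [hua])
    exact ⟨u, by simp [hf, hua]⟩
  have hfst : ∀ u a, (h (u, a)).1 = f u := fun u a => by
    obtain ⟨w, hw⟩ := hfsurj (h (u, a)).1
    have key : ∀ v, ‖w - v‖ ^ 2 + coneDist Z (h (u, a)).2 (conePt Z z₀) ^ 2 =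
        ‖u - v‖ ^ 2 + coneDist Z a (conePt Z z₀) ^ 2 := fun v => by
      have := hsq (u, a) (v, conePt Z z₀)
      rw [hz, ← hw] at this
      rwa [← dist_eq_norm w v, ← hfiso.dist_eq, dist_eq_norm]
    have k₁ := key u
    have k₂ := key w
    rw [sub_self, norm_zero] at k₁ k₂
    rw [norm_sub_rev u w] at k₂
    have : ‖w - u‖ ^ 2 = 0 := by linarith
    rw [← hw, sub_eq_zero.1 (norm_eq_zero.1 (pow_eq_zero_iff two_ne_zero |>.1 this))]
  have hsnd : ∀ u v a b, coneDist Z (h (u, a)).2 (h (v, b)).2 = coneDist Z a b :=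
    fun u v a b => by
      have := hsq (u, a) (v, b)
      rw [hfst, hfst, ← dist_eq_norm, hfiso.dist_eq, dist_eq_norm] at this
      exact (pow_left_inj₀ (coneDist_nonneg _ _) (coneDist_nonneg _ _) two_ne_zero).1
        (by linarith)
  have hconst : ∀ u a, (h (u, a)).2 = (h (0, a)).2 := fun u a =>
    eq_of_coneDist_eq_zero hπ (by rw [hsnd, coneDist_self])
  refine ⟨⟨Equiv.ofBijective f ⟨hfiso.injective, hfsurj⟩, hfiso⟩, fun a => (h (0, a)).2,
    ⟨fun a b hab => ?_, fun b => ?_⟩, hsnd 0 0, fun u a => Prod.ext (hfst u a) (hconst u a), hz 0⟩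
  · dsimp only at hab
    exact eq_of_coneDist_eq_zero hπ (by rw [← hsnd 0 0 a b, hab, coneDist_self])
  · obtain ⟨⟨u, a⟩, hua⟩ := hbij.surjective (0, b)
    exact ⟨a, by dsimp only; rw [← hconst u a, hua]⟩

theorem cone_isometry_map_conePt (hπ : ∀ z w : Z, dist z w < Real.pi) (z₀ : Z)
    {h : MetricCone Z → MetricCone Z} (hbij : Function.Bijective h)
    (hiso : ∀ a b : MetricCone Z, coneDist Z (h a) (h b) = coneDist Z a b) :
    h (conePt Z z₀) = conePt Z z₀ :=
  (map_snd_eq_conePt_iff (m := 0) (h := Prod.map id h) hπ z₀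
    (Function.bijective_id.prodMap hbij) (fun a b => by simp [prodConeDist, hiso])
    (0, conePt Z z₀)).2 rfl

theorem cone_isometry_induced (hπ : ∀ z w : Z, dist z w < Real.pi) (z₀ : Z)
    {h : MetricCone Z → MetricCone Z} (hbij : Function.Bijective h)
    (hiso : ∀ a b : MetricCone Z, coneDist Z (h a) (h b) = coneDist Z a b) :
    ∃ φ : Z ≃ᵢ Z, ∀ (t : { t : ℝ // 0 ≤ t }) (z : Z),
      h (Quotient.mk (coneSetoid Z) (t, z)) = Quotient.mk (coneSetoid Z) (t, φ z) := by
  have hpt := cone_isometry_map_conePt hπ z₀ hbij hiso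
  have hrad : ∀ (t : { t : ℝ // 0 ≤ t }) (z : Z), ∃ w : Z,
      h (Quotient.mk (coneSetoid Z) (t, z)) = Quotient.mk (coneSetoid Z) (t, w) := by
    intro t z
    obtain ⟨⟨s, w⟩, hw⟩ := Quotient.exists_rep (h (Quotient.mk (coneSetoid Z) (t, z)))
    have := hiso (Quotient.mk (coneSetoid Z) (t, z)) (conePt Z z₀)
    rw [hpt, ← hw, coneDist_mk_conePt, coneDist_mk_conePt] at this
    obtain rfl : s = t := Subtype.ext this
    exact ⟨w, hw.symm⟩
  have hcos : ∀ (s t : { t : ℝ // 0 ≤ t }) (z w z' w' : Z), (s : ℝ) ≠ 0 → (t : ℝ) ≠ 0 →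
      h (Quotient.mk (coneSetoid Z) (s, z)) = Quotient.mk (coneSetoid Z) (s, z') →
      h (Quotient.mk (coneSetoid Z) (t, w)) = Quotient.mk (coneSetoid Z) (t, w') →
      Real.cos (dist z' w') = Real.cos (dist z w) := by
    intro s t z w z' w' hs ht hz hw
    have h₁ := congrArg (· ^ 2)
      (hiso (Quotient.mk (coneSetoid Z) (s, z)) (Quotient.mk (coneSetoid Z) (t, w)))
    rw [hz, hw, coneDist_mk_sq, coneDist_mk_sq] at h₁
    apply mul_left_cancel₀ (mul_ne_zero hs ht)
    linarith
  let e : { t : ℝ // 0 ≤ t } := ⟨1, zero_le_one⟩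
  have he : (e : ℝ) ≠ 0 := one_ne_zero
  choose φ hφ using hrad e
  have hray : ∀ (t : { t : ℝ // 0 ≤ t }) (z : Z),
      h (Quotient.mk (coneSetoid Z) (t, z)) = Quotient.mk (coneSetoid Z) (t, φ z) := by
    intro t z
    rcases eq_or_ne (t : ℝ) 0 with ht | ht
    · rw [mk_eq_conePt z₀ z ht, mk_eq_conePt z₀ (φ z) ht, hpt]
    · obtain ⟨w, hw⟩ := hrad t z
      have := hcos t e z z w (φ z) ht he hw (hφ z)
      rw [dist_self, Real.cos_zero] at this
      rw [hw, eq_of_cos_dist_eq_one hπ this]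
  have hφiso : Isometry φ := Isometry.of_dist_eq fun z w =>
    Real.injOn_cos ⟨dist_nonneg, (hπ _ _).le⟩ ⟨dist_nonneg, (hπ _ _).le⟩
      (hcos e e z w _ _ he he (hφ z) (hφ w))
  have hφsurj : Function.Surjective φ := fun w => by
    obtain ⟨A, hA⟩ := hbij.surjective (Quotient.mk (coneSetoid Z) (e, w))
    obtain ⟨⟨t, z⟩, rfl⟩ := Quotient.exists_rep A
    rw [hray] at hA
    have hrel : (t, φ z) = (e, w) ∨ ((t : ℝ) = 0 ∧ (e : ℝ) = 0) := Quotient.exact hA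
    rcases hrel with heq | ⟨-, h0⟩
    · exact ⟨z, congrArg Prod.snd heq⟩
    · exact absurd h0 he
  exact ⟨⟨Equiv.ofBijective φ ⟨hφiso.injective, hφsurj⟩, hφiso⟩, hray⟩

end Splitting

/-- **Splitting of cone isometries.**  Let `C(Z)` be the metric cone over a
compact metric space `Z` of diameter `< π`, with cone point `z*`.  Then
(a) every isometry of `C(Z)` fixes the cone point `z*` and is induced by an
isometry of `Z` (so `Isom(C(Z)) ≅ Isom(Z)`), and
(b) the isometry group of `ℝᵐ × C(Z)` splits as
`Isom(ℝᵐ × C(Z)) = Isom(ℝᵐ) × Isom(C(Z))`: for every isometry `h` of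
`ℝᵐ × C(Z)` there is a unique pair `(h₁, h₂) ∈ Isom(ℝᵐ) × Isom(C(Z))` with
`h(u, z) = (h₁ u, h₂ z)` for all `(u, z)`, and `h₂ z* = z*`. -/
theorem cone_isometry_splitting
    (Z : Type) [MetricSpace Z] [CompactSpace Z] [Nonempty Z]
    (hdiam : Metric.diam (Set.univ : Set Z) < Real.pi) (z₀ : Z) (m : ℕ) :
    -- (a) every isometry of `C(Z)` fixes `z*` and is induced by an isometry of `Z`
    (∀ h : MetricCone Z → MetricCone Z, Function.Bijective h →
      (∀ a b : MetricCone Z, coneDist Z (h a) (h b) = coneDist Z a b) →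
      h (conePt Z z₀) = conePt Z z₀ ∧
      ∃ φ : Z ≃ᵢ Z, ∀ (t : { t : ℝ // 0 ≤ t }) (z : Z),
        h (Quotient.mk (coneSetoid Z) (t, z)) =
          Quotient.mk (coneSetoid Z) (t, φ z)) ∧
    -- (b) every isometry of `ℝᵐ × C(Z)` splits as a unique product of isometries,
    -- the cone factor fixing the cone point
    (∀ h : EuclideanSpace ℝ (Fin m) × MetricCone Z →
        EuclideanSpace ℝ (Fin m) × MetricCone Z,
      Function.Bijective h →
      (∀ a b, prodConeDist Z m (h a) (h b) = prodConeDist Z m a b) →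
      ∃ (h₁ : EuclideanSpace ℝ (Fin m) ≃ᵢ EuclideanSpace ℝ (Fin m))
        (h₂ : MetricCone Z → MetricCone Z),
        Function.Bijective h₂ ∧
        (∀ a b : MetricCone Z, coneDist Z (h₂ a) (h₂ b) = coneDist Z a b) ∧
        (∀ (u : EuclideanSpace ℝ (Fin m)) (a : MetricCone Z),
          h (u, a) = (h₁ u, h₂ a)) ∧
        h₂ (conePt Z z₀) = conePt Z z₀ ∧
        ∀ (h₁' : EuclideanSpace ℝ (Fin m) → EuclideanSpace ℝ (Fin m))
          (h₂' : MetricCone Z → MetricCone Z),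
          (∀ (u : EuclideanSpace ℝ (Fin m)) (a : MetricCone Z),
            h (u, a) = (h₁' u, h₂' a)) →
          (∀ u, h₁' u = h₁ u) ∧ ∀ a, h₂' a = h₂ a) := by
  have hπ : ∀ z w : Z, dist z w < Real.pi := fun z w =>
    (Metric.dist_le_diam_of_mem isCompact_univ.isBounded (Set.mem_univ z)
      (Set.mem_univ w)).trans_lt hdiam
  refine ⟨fun h hbij hiso => ⟨cone_isometry_map_conePt hπ z₀ hbij hiso,
    cone_isometry_induced hπ z₀ hbij hiso⟩, fun h hbij hiso => ?_⟩
  obtain ⟨h₁, h₂, hb, hi, hs, hp⟩ := prodCone_isometry_splits hπ z₀ hbij hiso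
  refine ⟨h₁, h₂, hb, hi, hs, hp, fun h₁' h₂' hs' => ⟨fun u => ?_, fun a => ?_⟩⟩
  · exact congrArg Prod.fst ((hs' u (conePt Z z₀)).symm.trans (hs u (conePt Z z₀)))
  · exact congrArg Prod.snd ((hs' 0 a).symm.trans (hs 0 a))
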